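/- arXiv:math/0507196 — 9 statements merged into one kernel-verified Lean document; each statement's English description precedes it below -/
import Mathlib

section
/- Let (S, *) be an LD-system. On the set Ŝ of nonempty finite sequences of elements of S, define ⃗s ⃗* ⃗t to be the sequence of the same length as ⃗t whose j-th entry is s₁*(s₂*(⋯*(s_p*t_j)⋯)) where p is the length of ⃗s, and let ⌢ denote concatenation of sequences. Then (Ŝ, ⃗*, ⌢) is an ALD-system: for all nonempty sequences ⃗s, ⃗t, ⃗u one has ⃗s ⃗* (⃗t ⃗* ⃗u) = (⃗s ⃗* ⃗t) ⃗* (⃗s ⃗* ⃗u), (⃗s ⌢ ⃗t) ⃗* ⃗u = ⃗s ⃗* (⃗t ⃗* ⃗u), and ⃗s ⃗* (⃗t ⌢ ⃗u) = (⃗s ⃗* ⃗t) ⌢ (⃗s ⃗* ⃗u). -/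
/-- Iterated left translation is an endomorphism of an LD-system. -/
theorem foldr_star_distrib {S : Type*} (star : S → S → S)
    (hLD : ∀ x y z : S, star x (star y z) = star (star x y) (star x z)) (s : List S) (y z : S) :
    s.foldr star (star y z) = star (s.foldr star y) (s.foldr star z) := by
  induction s with
  | nil => rfl
  | cons a s ih => rw [List.foldr_cons, ih, hLD, List.foldr_cons, List.foldr_cons]

/-- Iterated left translations distribute over iterated left translations. -/
theorem foldr_star_foldr_star {S : Type*} (star : S → S → S)
    (hLD : ∀ x y z : S, star x (star y z) = star (star x y) (star x z)) (s t : List S) (x : S) :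
    s.foldr star (t.foldr star x) =
      (t.map (fun y => s.foldr star y)).foldr star (s.foldr star x) := by
  induction t with
  | nil => rfl
  | cons b t ih =>
    rw [List.foldr_cons, List.map_cons, List.foldr_cons, foldr_star_distrib star hLD, ih]

/-- If `(S, *)` is an LD-system, then the set of nonempty finite sequences
over `S`, with the operation `⃗s ⃗* ⃗t := (s₁*(⋯*(s_p*t_j)⋯))_j` and concatenation,
is an ALD-system. -/
theorem seq_ALD_system {S : Type*} (star : S → S → S)
    (hLD : ∀ x y z : S, star x (star y z) = star (star x y) (star x z))
    (vstar : List S → List S → List S)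
    (hvstar : ∀ s t : List S, vstar s t = t.map (fun x => s.foldr star x)) :
    ∀ s t u : List S, s ≠ [] → t ≠ [] → u ≠ [] →
      vstar s (vstar t u) = vstar (vstar s t) (vstar s u) ∧
      vstar (s ++ t) u = vstar s (vstar t u) ∧
      vstar s (t ++ u) = vstar s t ++ vstar s u := by
  intro s t u _ _ _
  simp only [hvstar, List.map_map, List.map_append, List.foldr_append]
  refine ⟨List.map_congr_left fun x _ => ?_, ?_⟩
  · exact foldr_star_foldr_star star hLD s t x
  · exact ⟨rfl, trivial⟩
end

section
/- Let X be a nonempty set and let F be the free LD-system on X, i.e., the quotient of the free magma on X by the smallest congruence containing all pairs (s·(t·u), (s·t)·(s·u)), with induced operation *. Then there exists no binary operation ∘ on F satisfying (a∘b)*c = a*(b*c) for all a, b, c ∈ F. In other words, a free LD-system cannot be enriched into an ALD-system. -/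
/-- The smallest congruence on the free magma containing all instances of the
left self-distributivity law `s·(t·u) = (s·t)·(s·u)`. -/
inductive LDCong {X : Type*} : FreeMagma X → FreeMagma X → Prop
  | ld (s t u : FreeMagma X) : LDCong (s * (t * u)) ((s * t) * (s * u))
  | refl (s : FreeMagma X) : LDCong s s
  | symm {s t : FreeMagma X} : LDCong s t → LDCong t s
  | trans {s t u : FreeMagma X} : LDCong s t → LDCong t u → LDCong s u
  | mul {s s' t t' : FreeMagma X} : LDCong s s' → LDCong t t' →
      LDCong (s * t) (s' * t')

/-- The setoid of LD-equivalence on the free magma. -/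
def ldSetoid (X : Type*) : Setoid (FreeMagma X) :=
  ⟨LDCong, ⟨LDCong.refl, LDCong.symm, LDCong.trans⟩⟩

/-- The free LD-system on `X`: the quotient of the free magma on `X` by the
congruence generated by the instances of the LD law. -/
def FreeLD (X : Type*) : Type _ := Quotient (ldSetoid X)

/-- The operation induced on the free LD-system by the free magma operation. -/
def FreeLD.star {X : Type*} : FreeLD X → FreeLD X → FreeLD X :=
  Quotient.map₂ (· * ·) (fun _ _ h _ _ h' => LDCong.mul h h')

/-- The length of the rightmost branch of a term of the free magma. -/
def FreeMagma.rightDepth {X : Type*} : FreeMagma X → ℕ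
  | .of _ => 0
  | .mul _ t => rightDepth t + 1

theorem FreeMagma.rightDepth_mul {X : Type*} (s t : FreeMagma X) :
    (s * t).rightDepth = t.rightDepth + 1 := rfl

theorem LDCong.rightDepth_eq {X : Type*} {s t : FreeMagma X} (h : LDCong s t) :
    s.rightDepth = t.rightDepth := by
  induction h with
  | ld s t u => simp only [FreeMagma.rightDepth_mul]
  | refl s => rfl
  | symm _ ih => exact ih.symm
  | trans _ _ ih₁ ih₂ => exact ih₁.trans ih₂
  | mul _ _ _ ih => simp only [FreeMagma.rightDepth_mul, ih]

/-- The right depth is invariant under LD-equivalence. -/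
def FreeLD.rightDepth {X : Type*} : FreeLD X → ℕ :=
  Quotient.lift FreeMagma.rightDepth fun _ _ h => LDCong.rightDepth_eq h

theorem FreeLD.rightDepth_star {X : Type*} (a b : FreeLD X) :
    (FreeLD.star a b).rightDepth = b.rightDepth + 1 :=
  Quotient.inductionOn₂ a b fun _ _ => rfl

/-- a free LD-system on a nonempty set of generators admits no second
operation `∘` satisfying (ALD₁): it cannot be enriched into an ALD-system. -/
theorem freeLD_not_ALD (X : Type*) [Nonempty X] :
    ¬ ∃ circ : FreeLD X → FreeLD X → FreeLD X,
        ∀ a b c : FreeLD X,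
          FreeLD.star (circ a b) c = FreeLD.star a (FreeLD.star b c) := by
  rintro ⟨circ, h⟩
  obtain ⟨x⟩ := ‹Nonempty X›
  let a : FreeLD X := Quotient.mk (ldSetoid X) (FreeMagma.of x)
  have := congrArg FreeLD.rightDepth (h a a a)
  simp only [FreeLD.rightDepth_star] at this
  omega
end

section
/- In the absolutely free algebra T₂^{*,∘} of terms in two variables x₁, x₂ over two binary operation symbols * and ∘, the terms x₁ ∘ x₂ and (x₁ * x₂) ∘ x₁ are not ALD-equivalent. Consequently, free ALD-systems do not obey the law x∘y = (x*y)∘x, and hence are not LD-monoids. -/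
/-- Terms in `n` variables over two binary operation symbols `*` and `∘`. -/
inductive ALDTerm (n : ℕ) : Type
  | var : Fin n → ALDTerm n
  | star : ALDTerm n → ALDTerm n → ALDTerm n
  | circ : ALDTerm n → ALDTerm n → ALDTerm n

/-- The smallest congruence on terms containing all instances of the laws
(LD) `x*(y*z) = (x*y)*(x*z)`, (ALD₁) `(x∘y)*z = x*(y*z)`,
(ALD₂) `x*(y∘z) = (x*y)∘(x*z)`. -/
inductive ALDCong {n : ℕ} : ALDTerm n → ALDTerm n → Prop
  | LD (t₁ t₂ t₃ : ALDTerm n) :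
      ALDCong (.star t₁ (.star t₂ t₃)) (.star (.star t₁ t₂) (.star t₁ t₃))
  | ALD1 (t₁ t₂ t₃ : ALDTerm n) :
      ALDCong (.star (.circ t₁ t₂) t₃) (.star t₁ (.star t₂ t₃))
  | ALD2 (t₁ t₂ t₃ : ALDTerm n) :
      ALDCong (.star t₁ (.circ t₂ t₃)) (.circ (.star t₁ t₂) (.star t₁ t₃))
  | refl (t : ALDTerm n) : ALDCong t t
  | symm {s t : ALDTerm n} : ALDCong s t → ALDCong t s
  | trans {s t u : ALDTerm n} : ALDCong s t → ALDCong t u → ALDCong s u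
  | starCong {s s' t t' : ALDTerm n} : ALDCong s s' → ALDCong t t' →
      ALDCong (.star s t) (.star s' t')
  | circCong {s s' t t' : ALDTerm n} : ALDCong s s' → ALDCong t t' →
      ALDCong (.circ s t) (.circ s' t')

/-- The variable obtained by interpreting `*` as the second projection and `∘` as the first
projection; these operations on any set form an ALD-system. -/
def ALDTerm.projVar {n : ℕ} : ALDTerm n → Fin n
  | .var i => i
  | .star _ t => t.projVar
  | .circ s _ => s.projVar

theorem ALDCong.projVar_eq {n : ℕ} {s t : ALDTerm n} (h : ALDCong s t) :
    s.projVar = t.projVar := by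
  induction h with
  | LD | ALD1 | ALD2 | refl => rfl
  | symm _ ih => exact ih.symm
  | trans _ _ ih₁ ih₂ => exact ih₁.trans ih₂
  | starCong _ _ _ ih => exact ih
  | circCong _ _ ih _ => exact ih

/-- in the absolutely free algebra of terms in two variables, the terms
`x₁ ∘ x₂` and `(x₁ * x₂) ∘ x₁` are not ALD-equivalent; hence free ALD-systems do not
obey the law `x∘y = (x*y)∘x` and are not LD-monoids. -/
theorem not_ALD_equiv_circ_star :
    ¬ ALDCong (ALDTerm.circ (.var 0) (.var 1) : ALDTerm 2)
        (ALDTerm.circ (.star (.var 0) (.var 1)) (.var 0)) := by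
  intro h
  exact absurd h.projVar_eq (by simp [ALDTerm.projVar])
end

section
/- Define binary operations on B_• by β * γ := β · ∂γ · σ₁ · (∂β)⁻¹ and β ∘ γ := β · ∂γ · a₁. Then (B_•, *, ∘) is an ALD-system: for all β, γ, δ in B_•, β*(γ*δ) = (β*γ)*(β*δ), (β∘γ)*δ = β*(γ*δ), and β*(γ∘δ) = (β*γ)∘(β*δ). -/
namespace ParenBraid

/-- Generators of the parenthesized braid group: `Sum.inl i` stands for `σ_{i+1}` and
`Sum.inr i` stands for `a_{i+1}` (so the index `i : ℕ` ranges over `0, 1, 2, …`,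
representing the indices `1, 2, 3, …` of the paper). -/
abbrev Gen : Type := ℕ ⊕ ℕ

/-- The free-group generator `σ_{i+1}`. -/
def sg (i : ℕ) : FreeGroup Gen := FreeGroup.of (Sum.inl i)

/-- The free-group generator `a_{i+1}`. -/
def ag (i : ℕ) : FreeGroup Gen := FreeGroup.of (Sum.inr i)

/-- The defining relations of the parenthesized braid group `B_•`, written as words
`lhs * rhs⁻¹`:  `σ_jσ_i = σ_iσ_j` and `a_jσ_i = σ_i a_j` for `j ≥ i+2`;
`a_jσ_i = σ_{i+1} a_j` and `a_j a_i = a_{i+1} a_j` for `j ≤ i−1`; and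
`σ_{i+1}σ_iσ_{i+1} = σ_iσ_{i+1}σ_i`, `σ_iσ_{i+1} a_i = a_{i+1}σ_i`,
`σ_{i+1}σ_i a_{i+1} = a_iσ_i` for all `i ≥ 1`. -/
def rels : Set (FreeGroup Gen) :=
  {r | (∃ i j : ℕ, j ≥ i + 2 ∧ r = sg j * sg i * (sg i * sg j)⁻¹) ∨
       (∃ i j : ℕ, j ≥ i + 2 ∧ r = ag j * sg i * (sg i * ag j)⁻¹) ∨
       (∃ i j : ℕ, j < i ∧ r = ag j * sg i * (sg (i + 1) * ag j)⁻¹) ∨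
       (∃ i j : ℕ, j < i ∧ r = ag j * ag i * (ag (i + 1) * ag j)⁻¹) ∨
       (∃ i : ℕ, r = sg (i + 1) * sg i * sg (i + 1) * (sg i * sg (i + 1) * sg i)⁻¹) ∨
       (∃ i : ℕ, r = sg i * sg (i + 1) * ag i * (ag (i + 1) * sg i)⁻¹) ∨
       (∃ i : ℕ, r = sg (i + 1) * sg i * ag (i + 1) * (ag i * sg i)⁻¹)}

/-- The parenthesized braid group `B_•`. -/
def Bdot : Type := PresentedGroup rels

instance : Group Bdot := by unfold Bdot; infer_instance

/-- The generator `σ_{i+1}` of `B_•`. -/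
def σ (i : ℕ) : Bdot := PresentedGroup.of (Sum.inl i)

/-- The generator `a_{i+1}` of `B_•`. -/
def a (i : ℕ) : Bdot := PresentedGroup.of (Sum.inr i)


lemma mul_eq_mul_of_mem_rels {u v : FreeGroup Gen} (h : u * v⁻¹ ∈ rels) :
    (QuotientGroup.mk u : PresentedGroup rels) = QuotientGroup.mk v := by
  have := PresentedGroup.one_of_mem h
  rwa [map_mul, map_inv, mul_inv_eq_one] at this

lemma σ_mul_σ_of_le {i j : ℕ} (h : i + 2 ≤ j) : σ j * σ i = σ i * σ j :=
  mul_eq_mul_of_mem_rels (u := sg j * sg i) (v := sg i * sg j) (.inl ⟨i, j, h, rfl⟩)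

lemma a_mul_σ_of_le {i j : ℕ} (h : i + 2 ≤ j) : a j * σ i = σ i * a j :=
  mul_eq_mul_of_mem_rels (u := ag j * sg i) (v := sg i * ag j) (.inr (.inl ⟨i, j, h, rfl⟩))

lemma a_mul_σ_of_lt {i j : ℕ} (h : j < i) : a j * σ i = σ (i + 1) * a j :=
  mul_eq_mul_of_mem_rels (u := ag j * sg i) (v := sg (i + 1) * ag j)
    (.inr (.inr (.inl ⟨i, j, h, rfl⟩)))

lemma a_mul_a_of_lt {i j : ℕ} (h : j < i) : a j * a i = a (i + 1) * a j :=
  mul_eq_mul_of_mem_rels (u := ag j * ag i) (v := ag (i + 1) * ag j)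
    (.inr (.inr (.inr (.inl ⟨i, j, h, rfl⟩))))

lemma σ_braid (i : ℕ) : σ (i + 1) * σ i * σ (i + 1) = σ i * σ (i + 1) * σ i :=
  mul_eq_mul_of_mem_rels (u := sg (i + 1) * sg i * sg (i + 1)) (v := sg i * sg (i + 1) * sg i)
    (.inr (.inr (.inr (.inr (.inl ⟨i, rfl⟩)))))

lemma σ_mul_σ_succ_mul_a (i : ℕ) : σ i * σ (i + 1) * a i = a (i + 1) * σ i :=
  mul_eq_mul_of_mem_rels (u := sg i * sg (i + 1) * ag i) (v := ag (i + 1) * sg i)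
    (.inr (.inr (.inr (.inr (.inr (.inl ⟨i, rfl⟩))))))

lemma σ_succ_mul_σ_mul_a_succ (i : ℕ) : σ (i + 1) * σ i * a (i + 1) = a i * σ i :=
  mul_eq_mul_of_mem_rels (u := sg (i + 1) * sg i * ag (i + 1)) (v := ag i * sg i)
    (.inr (.inr (.inr (.inr (.inr (.inr ⟨i, rfl⟩))))))

lemma hom_ext {G : Type*} [Group G] {f g : Bdot →* G}
    (hσ : ∀ i, f (σ i) = g (σ i)) (ha : ∀ i, f (a i) = g (a i)) : f = g :=
  PresentedGroup.ext (rels := rels) (Sum.rec hσ ha)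

lemma σ_zero_commute_shift_shift {D : Bdot →* Bdot} (hDσ : ∀ i, D (σ i) = σ (i + 1))
    (hDa : ∀ i, D (a i) = a (i + 1)) (x : Bdot) : Commute (σ 0) (D (D x)) := by
  have h : (MulAut.conj (σ 0)).toMonoidHom.comp (D.comp D) = D.comp D := by
    apply hom_ext <;> intro i <;>
      simp [hDσ, hDa, mul_inv_eq_iff_eq_mul, σ_mul_σ_of_le, a_mul_σ_of_le]
  exact mul_inv_eq_iff_eq_mul.1 (DFunLike.congr_fun h x)

lemma a_zero_semiconjBy_shift {D : Bdot →* Bdot} (hDσ : ∀ i, D (σ i) = σ (i + 1))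
    (hDa : ∀ i, D (a i) = a (i + 1)) (x : Bdot) : SemiconjBy (a 0) (D x) (D (D x)) := by
  have h : (MulAut.conj (a 0)).toMonoidHom.comp D = D.comp D := by
    apply hom_ext <;> intro i <;>
      simp [hDσ, hDa, a_mul_σ_of_lt, a_mul_a_of_lt]
  exact mul_inv_eq_iff_eq_mul.1 (DFunLike.congr_fun h x)

/-- the operations `β * γ := β·∂γ·σ₁·(∂β)⁻¹` and `β ∘ γ := β·∂γ·a₁`
make `B_•` an ALD-system, where `∂` is the shift endomorphism of `B_•`. -/
theorem Bdot_ALD_system (D : Bdot →* Bdot)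
    (hDσ : ∀ i : ℕ, D (σ i) = σ (i + 1)) (hDa : ∀ i : ℕ, D (a i) = a (i + 1))
    (star circ : Bdot → Bdot → Bdot)
    (hstar : ∀ β γ : Bdot, star β γ = β * D γ * σ 0 * (D β)⁻¹)
    (hcirc : ∀ β γ : Bdot, circ β γ = β * D γ * a 0) :
    (∀ β γ δ : Bdot, star β (star γ δ) = star (star β γ) (star β δ)) ∧
    (∀ β γ δ : Bdot, star (circ β γ) δ = star β (star γ δ)) ∧
    (∀ β γ δ : Bdot, star β (circ γ δ) = circ (star β γ) (star β δ)) := by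
  have hσ (x) : σ 0 * D (D x) = D (D x) * σ 0 := σ_zero_commute_shift_shift hDσ hDa x
  have hσ' (x) : σ 0 * (D (D x))⁻¹ = (D (D x))⁻¹ * σ 0 :=
    (σ_zero_commute_shift_shift hDσ hDa x).inv_right
  have ha (x) : a 0 * D x = D (D x) * a 0 := a_zero_semiconjBy_shift hDσ hDa x
  have ha' (x) : a 0 * (D x)⁻¹ = (D (D x))⁻¹ * a 0 :=
    (a_zero_semiconjBy_shift hDσ hDa x).inv_right
  have hbraid : σ 0 * σ 1 * σ 0 * (σ 1)⁻¹ = σ 1 * σ 0 :=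
    mul_inv_eq_of_eq_mul (σ_braid 0).symm
  have haσ : a 0 * σ 0 * (a 1)⁻¹ = σ 1 * σ 0 :=
    mul_inv_eq_of_eq_mul (σ_succ_mul_σ_mul_a_succ 0).symm
  have hσσa : σ 0 * σ 1 * a 0 = a 1 * σ 0 := σ_mul_σ_succ_mul_a 0
  refine ⟨fun β γ δ ↦ ?_, fun β γ δ ↦ ?_, fun β γ δ ↦ ?_⟩ <;>
    simp only [hstar, hcirc, map_mul, map_inv, hDσ, hDa, zero_add]
  · calc
      _ = β * D γ * D (D δ) * σ 1 * ((D (D γ))⁻¹ * σ 0) * (D β)⁻¹ := by group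
      _ = β * D γ * D (D δ) * (σ 0 * σ 1 * σ 0 * (σ 1)⁻¹) * (D (D γ))⁻¹ * (D β)⁻¹ := by
        rw [← hσ', hbraid]; group
      _ = β * D γ * (σ 0 * D (D δ)) * σ 1 * ((D (D β))⁻¹ * σ 0) * D (D β) * (σ 1)⁻¹ *
          (D (D γ))⁻¹ * (D β)⁻¹ := by rw [hσ, ← hσ']; group
      _ = _ := by group
  · calc
      _ = β * D γ * (a 0 * D δ) * σ 0 * (a 1)⁻¹ * (D (D γ))⁻¹ * (D β)⁻¹ := by group
      _ = β * D γ * D (D δ) * (a 0 * σ 0 * (a 1)⁻¹) * (D (D γ))⁻¹ * (D β)⁻¹ := by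
        rw [ha]; group
      _ = β * D γ * D (D δ) * σ 1 * (σ 0 * (D (D γ))⁻¹) * (D β)⁻¹ := by rw [haσ]; group
      _ = _ := by rw [hσ']; group
  · calc
      _ = β * D γ * D (D δ) * (a 1 * σ 0) * (D β)⁻¹ := by group
      _ = β * D γ * (D (D δ) * σ 0) * σ 1 * (a 0 * (D β)⁻¹) := by rw [← hσσa]; group
      _ = _ := by rw [← hσ, ha']; group

end ParenBraid
end

section
/- If u and v are distinct terms of T₁^∘, then the element u(1)⁻¹ · v(1) of B_• does not belong to the image of the shift endomorphism ∂. -/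
namespace ParenBraid

/-- Terms in a single variable over the single operation symbol `∘`. -/
inductive CTerm : Type
  | var : CTerm
  | circ : CTerm → CTerm → CTerm

/-- The evaluation `v(1)` of a `∘`-term `v` in `(B_•, ∘)`, with every variable
occurrence assigned the identity `1`, where `β ∘ γ := β·∂γ·a₁`. -/
def evalC (D : Bdot →* Bdot) : CTerm → Bdot
  | .var => 1
  | .circ u v => evalC D u * D (evalC D v) * a 0

/-- The permutation of `ℕ × ℕ` exchanging the columns `i` and `i + 1`. -/
def columnSwap (i : ℕ) : Equiv.Perm (ℕ × ℕ) :=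
  Function.Involutive.toPerm
    (fun x => (if x.1 = i then i + 1 else if x.1 = i + 1 then i else x.1, x.2)) <| by
      rintro ⟨k, w⟩
      simp only [Prod.mk.injEq, and_true]
      split_ifs <;> omega

/-- The permutation of `ℕ × ℕ` splitting the column `i` into the columns `i` and `i + 1`
according to parity, and shifting the columns to its right. -/
def columnSplit (i : ℕ) : Equiv.Perm (ℕ × ℕ) where
  toFun x := (if x.1 < i then x.1 else if x.1 = i then i + x.2 % 2 else x.1 + 1,
    if x.1 = i then x.2 / 2 else x.2)
  invFun x := (if x.1 ≤ i then x.1 else x.1 - 1,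
    if x.1 = i then 2 * x.2 else if x.1 = i + 1 then 2 * x.2 + 1 else x.2)
  left_inv := by
    rintro ⟨k, w⟩
    simp only [Prod.mk.injEq]
    constructor <;> split_ifs <;> omega
  right_inv := by
    rintro ⟨k, w⟩
    simp only [Prod.mk.injEq]
    constructor <;> split_ifs <;> omega

theorem columnSwap_apply (i : ℕ) (x : ℕ × ℕ) :
    columnSwap i x = (if x.1 = i then i + 1 else if x.1 = i + 1 then i else x.1, x.2) := rfl

theorem columnSplit_apply (i : ℕ) (x : ℕ × ℕ) :
    columnSplit i x = (if x.1 < i then x.1 else if x.1 = i then i + x.2 % 2 else x.1 + 1,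
      if x.1 = i then x.2 / 2 else x.2) := rfl

/-- The images of the generators of `B_•` in the permutations of `ℕ × ℕ`. -/
def genPerm : Gen → Equiv.Perm (ℕ × ℕ) := Sum.elim columnSwap columnSplit

theorem lift_genPerm_rels : ∀ r ∈ rels, FreeGroup.lift genPerm r = 1 := by
  rintro r (⟨i, j, h, rfl⟩ | ⟨i, j, h, rfl⟩ | ⟨i, j, h, rfl⟩ | ⟨i, j, h, rfl⟩ |
    ⟨i, rfl⟩ | ⟨i, rfl⟩ | ⟨i, rfl⟩) <;>
  · rw [map_mul, map_inv, mul_inv_eq_one]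
    ext ⟨k, w⟩ <;>
    · simp only [map_mul, sg, ag, FreeGroup.lift_apply_of, genPerm, Sum.elim_inl, Sum.elim_inr,
        Equiv.Perm.mul_apply, columnSwap_apply, columnSplit_apply] <;>
      grind

/-- The action of `B_•` on `ℕ × ℕ`, where the column `{k} × ℕ` is the `k`-th strand. -/
def toPerm : Bdot →* Equiv.Perm (ℕ × ℕ) := PresentedGroup.toGroup lift_genPerm_rels

theorem toPerm_σ (i : ℕ) : toPerm (σ i) = columnSwap i :=
  PresentedGroup.toGroup.of lift_genPerm_rels

theorem toPerm_a (i : ℕ) : toPerm (a i) = columnSplit i :=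
  PresentedGroup.toGroup.of lift_genPerm_rels

theorem toPerm_shift_zero {D : Bdot →* Bdot} (hDσ : ∀ i : ℕ, D (σ i) = σ (i + 1))
    (hDa : ∀ i : ℕ, D (a i) = a (i + 1)) (γ : Bdot) (w : ℕ) :
    toPerm (D γ) (0, w) = (0, w) := by
  let S : Subgroup Bdot := (MulAction.stabilizer (Equiv.Perm (ℕ × ℕ)) (0, w)).comap (toPerm.comp D)
  have h : (⊤ : Subgroup Bdot) ≤ S := by
    refine (PresentedGroup.closure_range_of rels).ge.trans ((Subgroup.closure_le S).2 ?_)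
    rintro _ ⟨i | i, rfl⟩
    · change toPerm (D (σ i)) (0, w) = (0, w)
      rw [hDσ, toPerm_σ]
      simp [columnSwap_apply]
    · change toPerm (D (a i)) (0, w) = (0, w)
      rw [hDa, toPerm_a]
      simp [columnSplit_apply]
  exact h (Subgroup.mem_top γ)

theorem toPerm_shift_succ {D : Bdot →* Bdot} (hDσ : ∀ i : ℕ, D (σ i) = σ (i + 1))
    (hDa : ∀ i : ℕ, D (a i) = a (i + 1)) (γ : Bdot) (x : ℕ × ℕ) :
    toPerm (D γ) (x.1 + 1, x.2) = ((toPerm γ x).1 + 1, (toPerm γ x).2) := by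
  let S : Subgroup Bdot :=
    { carrier := {γ | ∀ x : ℕ × ℕ,
        toPerm (D γ) (x.1 + 1, x.2) = ((toPerm γ x).1 + 1, (toPerm γ x).2)}
      one_mem' := by simp
      mul_mem' := by
        intro β γ hβ hγ x
        simp only [map_mul, Equiv.Perm.mul_apply]
        rw [hγ x, hβ]
      inv_mem' := by
        intro γ hγ x
        rw [map_inv, map_inv, Equiv.Perm.inv_eq_iff_eq, map_inv, hγ]
        simp }
  have h : (⊤ : Subgroup Bdot) ≤ S := by
    refine (PresentedGroup.closure_range_of rels).ge.trans ((Subgroup.closure_le S).2 ?_)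
    rintro _ ⟨i | i, rfl⟩ x
    · change toPerm (D (σ i)) _ = ((toPerm (σ i) x).1 + 1, (toPerm (σ i) x).2)
      rw [hDσ, toPerm_σ, toPerm_σ]
      simp only [columnSwap_apply]
      grind
    · change toPerm (D (a i)) _ = ((toPerm (a i) x).1 + 1, (toPerm (a i) x).2)
      rw [hDa, toPerm_a, toPerm_a]
      simp only [columnSplit_apply]
      grind
  exact h (Subgroup.mem_top γ) x

theorem toPerm_evalC_circ_even {D : Bdot →* Bdot} (hDσ : ∀ i : ℕ, D (σ i) = σ (i + 1))
    (hDa : ∀ i : ℕ, D (a i) = a (i + 1)) (u v : CTerm) (w : ℕ) :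
    toPerm (evalC D (.circ u v)) (0, 2 * w) = toPerm (evalC D u) (0, w) := by
  have h : columnSplit 0 (0, 2 * w) = (0, w) := by simp [columnSplit_apply]
  simp only [evalC, map_mul, Equiv.Perm.mul_apply, toPerm_a, h, toPerm_shift_zero hDσ hDa]

theorem toPerm_evalC_circ_odd {D : Bdot →* Bdot} (hDσ : ∀ i : ℕ, D (σ i) = σ (i + 1))
    (hDa : ∀ i : ℕ, D (a i) = a (i + 1)) (u v : CTerm) (w : ℕ) :
    toPerm (evalC D (.circ u v)) (0, 2 * w + 1) =
      toPerm (evalC D u) ((toPerm (evalC D v) (0, w)).1 + 1, (toPerm (evalC D v) (0, w)).2) := by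
  have h : columnSplit 0 (0, 2 * w + 1) = (0 + 1, w) := by
    simp only [columnSplit_apply, Prod.mk.injEq]
    grind
  simp only [evalC, map_mul, Equiv.Perm.mul_apply, toPerm_a, h,
    toPerm_shift_succ hDσ hDa (evalC D v) (0, w)]

theorem not_forall_toPerm_evalC_eq_mul {D : Bdot →* Bdot}
    (hDσ : ∀ i : ℕ, D (σ i) = σ (i + 1)) (hDa : ∀ i : ℕ, D (a i) = a (i + 1))
    (u : CTerm) {n : ℕ} (hn : 2 ≤ n) :
    ¬ ∀ w : ℕ, toPerm (evalC D u) (0, w) = (0, n * w) := by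
  induction u generalizing n with
  | var =>
    intro h
    have := h 1
    simp [evalC] at this
    omega
  | circ u v ihu _ =>
    intro h
    refine ihu (n := n * 2) (by omega) fun w => ?_
    rw [← toPerm_evalC_circ_even hDσ hDa u v, h, mul_assoc]

theorem not_forall_toPerm_evalC_circ_eq {D : Bdot →* Bdot}
    (hDσ : ∀ i : ℕ, D (σ i) = σ (i + 1)) (hDa : ∀ i : ℕ, D (a i) = a (i + 1)) (u v : CTerm) :
    ¬ ∀ w : ℕ, toPerm (evalC D (.circ u v)) (0, w) = (0, w) := fun h =>
  not_forall_toPerm_evalC_eq_mul hDσ hDa u le_rfl fun w => by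
    rw [← toPerm_evalC_circ_even hDσ hDa u v, h]

theorem eq_of_toPerm_evalC_eq {D : Bdot →* Bdot}
    (hDσ : ∀ i : ℕ, D (σ i) = σ (i + 1)) (hDa : ∀ i : ℕ, D (a i) = a (i + 1)) {u v : CTerm}
    (h : ∀ w : ℕ, toPerm (evalC D u) (0, w) = toPerm (evalC D v) (0, w)) : u = v := by
  induction u generalizing v with
  | var =>
    cases v with
    | var => rfl
    | circ p q =>
      exact (not_forall_toPerm_evalC_circ_eq hDσ hDa p q fun w => by
        rw [← h]
        simp [evalC]).elim
  | circ p q ihp ihq =>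
    cases v with
    | var =>
      exact (not_forall_toPerm_evalC_circ_eq hDσ hDa p q fun w => by
        rw [h]
        simp [evalC]).elim
    | circ p' q' =>
      obtain rfl : p = p' := ihp fun w => by
        rw [← toPerm_evalC_circ_even hDσ hDa p q, h, toPerm_evalC_circ_even hDσ hDa]
      obtain rfl : q = q' := ihq fun w => by
        have hw := h (2 * w + 1)
        rw [toPerm_evalC_circ_odd hDσ hDa, toPerm_evalC_circ_odd hDσ hDa] at hw
        have hw := (toPerm (evalC D p)).injective hw
        simp only [Prod.mk.injEq, Nat.add_right_cancel_iff] at hw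
        exact Prod.ext hw.1 hw.2
      rfl

/-- if `u ≠ v` are `∘`-terms, then `u(1)⁻¹·v(1)` does not belong to
the image of the shift endomorphism `∂` of `B_•`. -/
theorem evalC_quot_not_in_shift_range (D : Bdot →* Bdot)
    (hDσ : ∀ i : ℕ, D (σ i) = σ (i + 1)) (hDa : ∀ i : ℕ, D (a i) = a (i + 1))
    (u v : CTerm) (huv : u ≠ v) :
    (evalC D u)⁻¹ * evalC D v ∉ Set.range D := by
  rintro ⟨γ, hγ⟩
  refine huv (eq_of_toPerm_evalC_eq hDσ hDa fun w => ?_)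
  rw [← mul_inv_cancel_left (evalC D u) (evalC D v), ← hγ, map_mul, Equiv.Perm.mul_apply,
    toPerm_shift_zero hDσ hDa]

end ParenBraid
end

section
/- Let G be a group, ∂ : G → G a group homomorphism, and σ, a ∈ G. Set σ_i := ∂^{i−1}(σ) and a_i := ∂^{i−1}(a), define x * y := x · ∂y · σ₁ · (∂x)⁻¹ and x ∘ y := x · ∂y · a₁, and let H be the subgroup of G generated by all the σ_i and a_i. If the operations * and ∘ satisfy (LD) x*(y*z) = (x*y)*(x*z), (ALD₁) (x∘y)*z = x*(y*z), and (ALD₂) x*(y∘z) = (x*y)∘(x*z) for all x, y, z ∈ H, then the elements σ_i, a_i satisfy all the defining relations of B_•: σ_jσ_i = σ_iσ_j and a_jσ_i = σ_i a_j for j ≥ i+2; a_jσ_i = σ_{i+1} a_j and a_j a_i = a_{i+1} a_j for j ≤ i−1; and σ_{i+1}σ_iσ_{i+1} = σ_iσ_{i+1}σ_i, σ_iσ_{i+1} a_i = a_{i+1}σ_i, σ_{i+1}σ_i a_{i+1} = a_iσ_i for all i ≥ 1. -/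
/-- let `G` be a group, `∂` an endomorphism of `G`, `σ, a ∈ G`,
`σ_{i+1} := ∂^i(σ)`, `a_{i+1} := ∂^i(a)` (here `sig i` and `av i` denote `σ_{i+1}` and
`a_{i+1}`, so that indices are shifted by one with respect to the paper), and define
`x * y := x·∂y·σ₁·(∂x)⁻¹` and `x ∘ y := x·∂y·a₁`. If the laws (LD), (ALD₁), (ALD₂)
hold for all elements of the subgroup `H` generated by the `σ_i` and the `a_i`, then
the `σ_i, a_i` satisfy all the defining relations of `B_•`. -/
theorem relations_of_ALD {G : Type*} [Group G] (D : G →* G) (σ a : G)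
    (sig av : ℕ → G)
    (hsig : ∀ i : ℕ, sig i = (⇑D)^[i] σ) (hav : ∀ i : ℕ, av i = (⇑D)^[i] a)
    (star circ : G → G → G)
    (hstar : ∀ x y : G, star x y = x * D y * σ * (D x)⁻¹)
    (hcirc : ∀ x y : G, circ x y = x * D y * a)
    (H : Subgroup G)
    (hH : H = Subgroup.closure (Set.range sig ∪ Set.range av))
    (hLD : ∀ x ∈ H, ∀ y ∈ H, ∀ z ∈ H,
      star x (star y z) = star (star x y) (star x z))
    (hALD1 : ∀ x ∈ H, ∀ y ∈ H, ∀ z ∈ H,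
      star (circ x y) z = star x (star y z))
    (hALD2 : ∀ x ∈ H, ∀ y ∈ H, ∀ z ∈ H,
      star x (circ y z) = circ (star x y) (star x z)) :
    (∀ i j : ℕ, j ≥ i + 2 → sig j * sig i = sig i * sig j) ∧
    (∀ i j : ℕ, j ≥ i + 2 → av j * sig i = sig i * av j) ∧
    (∀ i j : ℕ, j < i → av j * sig i = sig (i + 1) * av j) ∧
    (∀ i j : ℕ, j < i → av j * av i = av (i + 1) * av j) ∧
    (∀ i : ℕ, sig (i + 1) * sig i * sig (i + 1) = sig i * sig (i + 1) * sig i) ∧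
    (∀ i : ℕ, sig i * sig (i + 1) * av i = av (i + 1) * sig i) ∧
    (∀ i : ℕ, sig (i + 1) * sig i * av (i + 1) = av i * sig i) := by
  have sig_mem (i : ℕ) : sig i ∈ H := hH ▸ Subgroup.subset_closure (Or.inl ⟨i, rfl⟩)
  have av_mem (i : ℕ) : av i ∈ H := hH ▸ Subgroup.subset_closure (Or.inr ⟨i, rfl⟩)
  have iter_sig (n m : ℕ) : (⇑D)^[n] (sig m) = sig (n + m) := by
    rw [hsig, hsig, Function.iterate_add_apply]
  have iter_av (n m : ℕ) : (⇑D)^[n] (av m) = av (n + m) := by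
    rw [hav, hav, Function.iterate_add_apply]
  have D_sig (m : ℕ) : D (sig m) = sig (m + 1) := by rw [Nat.add_comm]; exact iter_sig 1 m
  have D_av (m : ℕ) : D (av m) = av (m + 1) := by rw [Nat.add_comm]; exact iter_av 1 m
  obtain rfl : sig 0 = σ := hsig 0
  obtain rfl : av 0 = a := hav 0
  have braid : sig 1 * sig 0 * sig 1 = sig 0 * sig 1 * sig 0 := by
    have h := hLD 1 H.one_mem 1 H.one_mem 1 H.one_mem
    simp only [hstar, map_one, one_mul, mul_one, inv_one, D_sig] at h
    rw [h]; group
  have comm_sig (z : G) (hz : z ∈ H) : D (D z) * sig 0 = sig 0 * D (D z) := by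
    have h := hLD 1 H.one_mem 1 H.one_mem z hz
    simp only [hstar, map_one, map_mul, one_mul, mul_one, inv_one, D_sig] at h
    have conj : sig 1 * sig 0 * (sig 1)⁻¹ = (sig 0)⁻¹ * (sig 1 * sig 0) := by
      rw [mul_inv_eq_iff_eq_mul, mul_assoc (sig 0)⁻¹, braid]; group
    have h' : D (D z) * (sig 1 * sig 0) =
        sig 0 * D (D z) * (sig 1 * sig 0 * (sig 1)⁻¹) := by
      simpa only [mul_assoc] using h
    rw [conj, ← mul_assoc _ (sig 0)⁻¹] at h'
    exact eq_mul_inv_iff_mul_eq.mp (mul_right_cancel h')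
  have sig_sig_av : sig 1 * sig 0 * av 1 = av 0 * sig 0 := by
    have h := hALD1 1 H.one_mem 1 H.one_mem 1 H.one_mem
    simp only [hstar, hcirc, map_one, one_mul, mul_one, inv_one, D_sig, D_av] at h
    rw [← h]; group
  have av_shift (z : G) (hz : z ∈ H) : av 0 * D z = D (D z) * av 0 := by
    have h := hALD1 1 H.one_mem 1 H.one_mem z hz
    simp only [hstar, hcirc, map_one, map_mul, one_mul, mul_one, inv_one, D_sig, D_av] at h
    rw [mul_inv_eq_iff_eq_mul, mul_assoc (D (D z)), mul_assoc (D (D z)), sig_sig_av,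
      ← mul_assoc] at h
    exact mul_right_cancel h
  have sig_av : sig 0 * sig 1 * av 0 = av 1 * sig 0 := by
    have h := hALD2 1 H.one_mem 1 H.one_mem 1 H.one_mem
    simp only [hstar, hcirc, map_one, one_mul, mul_one, inv_one, D_sig, D_av] at h
    exact h.symm
  refine ⟨fun i j hij => ?_, fun i j hij => ?_, fun i j hij => ?_, fun i j hij => ?_,
    fun i => ?_, fun i => ?_, fun i => ?_⟩
  · obtain ⟨k, rfl⟩ := Nat.exists_eq_add_of_le hij
    rw [Nat.add_right_comm i 2 k]
    simpa only [iterate_map_mul, D_sig, iter_sig, add_zero, add_assoc,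
      Nat.reduceAdd] using congrArg (⇑D)^[i] (comm_sig _ (sig_mem k))
  · obtain ⟨k, rfl⟩ := Nat.exists_eq_add_of_le hij
    rw [Nat.add_right_comm i 2 k]
    simpa only [iterate_map_mul, D_av, iter_av, iter_sig, add_zero, add_assoc,
      Nat.reduceAdd] using congrArg (⇑D)^[i] (comm_sig _ (av_mem k))
  · obtain ⟨k, rfl⟩ := Nat.exists_eq_add_of_lt hij
    simpa only [iterate_map_mul, D_sig, iter_av, iter_sig, add_zero, add_assoc]
      using congrArg (⇑D)^[j] (av_shift _ (sig_mem k))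
  · obtain ⟨k, rfl⟩ := Nat.exists_eq_add_of_lt hij
    simpa only [iterate_map_mul, D_av, iter_av, add_zero, add_assoc]
      using congrArg (⇑D)^[j] (av_shift _ (av_mem k))
  · simpa only [iterate_map_mul, iter_sig, add_zero] using congrArg (⇑D)^[i] braid
  · simpa only [iterate_map_mul, iter_sig, iter_av, add_zero] using congrArg (⇑D)^[i] sig_av
  · simpa only [iterate_map_mul, iter_sig, iter_av, add_zero] using congrArg (⇑D)^[i] sig_sig_av
end

section
/- Let G be a group, ∂ : G → G a group homomorphism, and σ, a ∈ G. Set σ_i := ∂^{i−1}(σ) and a_i := ∂^{i−1}(a), define x * y := x · ∂y · σ₁ · (∂x)⁻¹ and x ∘ y := x · ∂y · a₁, and let H be the subgroup of G generated by all the σ_i and a_i. If the elements σ_i, a_i satisfy the relations σ_jσ_i = σ_iσ_j and a_jσ_i = σ_i a_j for j ≥ i+2; a_jσ_i = σ_{i+1} a_j and a_j a_i = a_{i+1} a_j for j ≤ i−1; and σ_{i+1}σ_iσ_{i+1} = σ_iσ_{i+1}σ_i, σ_iσ_{i+1} a_i = a_{i+1}σ_i, σ_{i+1}σ_i a_{i+1}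 = a_iσ_i for all i ≥ 1, then the operations * and ∘ satisfy (LD) x*(y*z) = (x*y)*(x*z), (ALD₁) (x∘y)*z = x*(y*z), and (ALD₂) x*(y∘z) = (x*y)∘(x*z) for all x, y, z ∈ H; i.e., (H, *, ∘) is an ALD-system. -/
/-- let `G` be a group, `∂` an endomorphism of `G`, `σ, a ∈ G`,
`σ_{i+1} := ∂^i(σ)`, `a_{i+1} := ∂^i(a)` (here `sig i` and `av i` denote `σ_{i+1}` and
`a_{i+1}`, so that indices are shifted by one with respect to the paper), and define
`x * y := x·∂y·σ₁·(∂x)⁻¹` and `x ∘ y := x·∂y·a₁`. If the `σ_i, a_i` satisfy all the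
defining relations of `B_•`, then the laws (LD), (ALD₁), (ALD₂) hold for all elements
of the subgroup `H` generated by the `σ_i` and the `a_i`: `(H, *, ∘)` is an
ALD-system. -/
theorem ALD_of_relations {G : Type*} [Group G] (D : G →* G) (σ a : G)
    (sig av : ℕ → G)
    (hsig : ∀ i : ℕ, sig i = (⇑D)^[i] σ) (hav : ∀ i : ℕ, av i = (⇑D)^[i] a)
    (star circ : G → G → G)
    (hstar : ∀ x y : G, star x y = x * D y * σ * (D x)⁻¹)
    (hcirc : ∀ x y : G, circ x y = x * D y * a)
    (H : Subgroup G)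
    (hH : H = Subgroup.closure (Set.range sig ∪ Set.range av))
    (hrel₁ : ∀ i j : ℕ, j ≥ i + 2 → sig j * sig i = sig i * sig j)
    (hrel₂ : ∀ i j : ℕ, j ≥ i + 2 → av j * sig i = sig i * av j)
    (hrel₃ : ∀ i j : ℕ, j < i → av j * sig i = sig (i + 1) * av j)
    (hrel₄ : ∀ i j : ℕ, j < i → av j * av i = av (i + 1) * av j)
    (hrel₅ : ∀ i : ℕ, sig (i + 1) * sig i * sig (i + 1) = sig i * sig (i + 1) * sig i)
    (hrel₆ : ∀ i : ℕ, sig i * sig (i + 1) * av i = av (i + 1) * sig i)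
    (hrel₇ : ∀ i : ℕ, sig (i + 1) * sig i * av (i + 1) = av i * sig i) :
    (∀ x ∈ H, ∀ y ∈ H, ∀ z ∈ H,
      star x (star y z) = star (star x y) (star x z)) ∧
    (∀ x ∈ H, ∀ y ∈ H, ∀ z ∈ H,
      star (circ x y) z = star x (star y z)) ∧
    (∀ x ∈ H, ∀ y ∈ H, ∀ z ∈ H,
      star x (circ y z) = circ (star x y) (star x z)) := by
  have hDsig : ∀ i, D (sig i) = sig (i + 1) := fun i => by
    rw [hsig, hsig, Function.iterate_succ_apply']
  have hDav : ∀ i, D (av i) = av (i + 1) := fun i => by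
    rw [hav, hav, Function.iterate_succ_apply']
  obtain rfl : sig 0 = σ := hsig 0
  obtain rfl : av 0 = a := hav 0
  have hcomm : ∀ x ∈ H, D (D x) * sig 0 = sig 0 * D (D x) := by
    have hle : H ≤ (Subgroup.centralizer {sig 0}).comap (D.comp D) := by
      rw [hH, Subgroup.closure_le]
      rintro _ (⟨i, rfl⟩ | ⟨i, rfl⟩)
      · simp only [SetLike.mem_coe, Subgroup.mem_comap, Subgroup.mem_centralizer_singleton_iff,
          MonoidHom.comp_apply, hDsig]
        exact hrel₁ 0 (i + 2) (by omega)
      · simp only [SetLike.mem_coe, Subgroup.mem_comap, Subgroup.mem_centralizer_singleton_iff,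
          MonoidHom.comp_apply, hDav]
        exact hrel₂ 0 (i + 2) (by omega)
    exact fun x hx => Subgroup.mem_centralizer_singleton_iff.mp (hle hx)
  have hshift : ∀ x ∈ H, av 0 * D x = D (D x) * av 0 := by
    have hle : H ≤ ((MulAut.conj (av 0)).toMonoidHom.comp D).eqLocus (D.comp D) := by
      rw [hH, Subgroup.closure_le]
      rintro _ (⟨i, rfl⟩ | ⟨i, rfl⟩)
      · change av 0 * D (sig i) * (av 0)⁻¹ = D (D (sig i))
        rw [hDsig, hDsig, hrel₃ (i + 1) 0 (by omega), mul_inv_cancel_right]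
      · change av 0 * D (av i) * (av 0)⁻¹ = D (D (av i))
        rw [hDav, hDav, hrel₄ (i + 1) 0 (by omega), mul_inv_cancel_right]
    intro x hx
    have h : av 0 * D x * (av 0)⁻¹ = D (D x) := hle hx
    rw [← h, inv_mul_cancel_right]
  have hbraid := hrel₅ 0
  have hσσa := hrel₆ 0
  have hσσa' := hrel₇ 0
  simp only [zero_add] at hbraid hσσa hσσa'
  refine ⟨fun x hx y hy z hz => ?_, fun x _ y hy z hz => ?_, fun x hx y _ z hz => ?_⟩
  · simp only [hstar, map_mul, map_inv, hDsig, zero_add]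
    have hx' := hcomm x⁻¹ (inv_mem hx)
    have hy' := hcomm y⁻¹ (inv_mem hy)
    have hz' := hcomm z hz
    simp only [map_inv] at hx' hy'
    calc x * (D y * D (D z) * sig 1 * (D (D y))⁻¹) * sig 0 * (D x)⁻¹
        = x * D y * D (D z) * sig 1 * ((D (D y))⁻¹ * sig 0) * (D x)⁻¹ := by group
      _ = x * D y * D (D z) * (sig 1 * sig 0 * sig 1) * (sig 1)⁻¹ * (D (D y))⁻¹
            * (D x)⁻¹ := by rw [hy']; group
      _ = x * D y * (D (D z) * sig 0) * sig 1 * sig 0 * (sig 1)⁻¹ * (D (D y))⁻¹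
            * (D x)⁻¹ := by rw [hbraid]; group
      _ = x * D y * sig 0 * D (D z) * sig 1 * (sig 0 * (D (D x))⁻¹) * D (D x)
            * (sig 1)⁻¹ * (D (D y))⁻¹ * (D x)⁻¹ := by rw [hz']; group
      _ = _ := by rw [← hx']; group
  · simp only [hstar, hcirc, map_mul, map_inv, hDsig, hDav, zero_add]
    have hy' := hcomm y⁻¹ (inv_mem hy)
    simp only [map_inv] at hy'
    calc x * D y * av 0 * D z * sig 0 * (D x * D (D y) * av 1)⁻¹
        = x * D y * (av 0 * D z) * sig 0 * (av 1)⁻¹ * (D (D y))⁻¹ * (D x)⁻¹ := by group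
      _ = x * D y * D (D z) * (av 0 * sig 0) * (av 1)⁻¹ * (D (D y))⁻¹ * (D x)⁻¹ := by
          rw [hshift z hz]; group
      _ = x * D y * D (D z) * sig 1 * (sig 0 * (D (D y))⁻¹) * (D x)⁻¹ := by
          rw [← hσσa']; group
      _ = _ := by rw [← hy']; group
  · simp only [hstar, hcirc, map_mul, map_inv, hDav, hDsig, zero_add]
    have hx' := hshift x⁻¹ (inv_mem hx)
    simp only [map_inv] at hx'
    calc x * (D y * D (D z) * av 1) * sig 0 * (D x)⁻¹
        = x * D y * D (D z) * (av 1 * sig 0) * (D x)⁻¹ := by group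
      _ = x * D y * (D (D z) * sig 0) * sig 1 * (av 0 * (D x)⁻¹) := by rw [← hσσa]; group
      _ = _ := by rw [hcomm z hz, hx']; group
end

section
/- Let G be a group, ∂ : G → G a group homomorphism, and σ ∈ G. Define x * y := x · ∂y · σ · (∂x)⁻¹. If x*(y*z) = (x*y)*(x*z) holds for all x, y, z ∈ G, then σ · ∂σ · σ = ∂σ · σ · ∂σ (the braid relation σ₁σ₂σ₁ = σ₂σ₁σ₂) and ∂²(z) · σ = σ · ∂²(z) for every z ∈ G. -/
/-- let `G` be a group, `∂` an endomorphism of `G`, `σ ∈ G`, and define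
`x * y := x·∂y·σ·(∂x)⁻¹`. If the law (LD) holds on `G`, then the braid relation
`σ·∂σ·σ = ∂σ·σ·∂σ` (i.e. `σ₁σ₂σ₁ = σ₂σ₁σ₂`) holds and `∂²(z)·σ = σ·∂²(z)` for
every `z ∈ G`. -/
theorem braid_of_LD {G : Type*} [Group G] (D : G →* G) (σ : G)
    (star : G → G → G)
    (hstar : ∀ x y : G, star x y = x * D y * σ * (D x)⁻¹)
    (hLD : ∀ x y z : G, star x (star y z) = star (star x y) (star x z)) :
    σ * D σ * σ = D σ * σ * D σ ∧ ∀ z : G, D (D z) * σ = σ * D (D z) := by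
  have key : ∀ z : G, D (D z) * D σ * σ = σ * D (D z) * D σ * σ * (D σ)⁻¹ := by
    intro z
    have h := hLD 1 1 z
    simp only [hstar, map_mul, map_one, inv_one, one_mul, mul_one] at h
    simpa [mul_assoc] using h
  have braid : σ * D σ * σ = D σ * σ * D σ := by
    have h := key 1
    simp only [map_one, one_mul, mul_one] at h
    exact (eq_mul_inv_iff_mul_eq.mp h).symm
  refine ⟨braid, fun z => ?_⟩
  have h := eq_mul_inv_iff_mul_eq.mp (key z)
  apply mul_right_cancel (b := D σ * σ)
  calc D (D z) * σ * (D σ * σ) = D (D z) * (σ * D σ * σ) := by group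
    _ = D (D z) * D σ * σ * D σ := by rw [braid]; group
    _ = σ * D (D z) * (D σ * σ) := by rw [h]; group
end

section
/- Let G be a group, ∂ : G → G a group homomorphism, and σ, a ∈ G. Define x * y := x · ∂y · σ · (∂x)⁻¹ and x ∘ y := x · ∂y · a. (i) If (x∘y)*z = x*(y*z) holds for all x, y, z ∈ G, then ∂σ · σ · ∂a = a · σ (i.e., σ₂σ₁a₂ = a₁σ₁) and ∂²(z) · a = a · ∂(z) for every z ∈ G. (ii) If x*(y∘z) = (x*y)∘(x*z) holds for all x, y, z ∈ G, then ∂a · σ = σ · ∂σ · a (i.e., a₂σ₁ = σ₁σ₂a₁). -/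
/-- let `G` be a group, `∂` an endomorphism of `G`, `σ, a ∈ G`, and
define `x * y := x·∂y·σ·(∂x)⁻¹`, `x ∘ y := x·∂y·a`. (i) If (ALD₁) holds on `G`,
then `∂σ·σ·∂a = a·σ` (i.e. `σ₂σ₁a₂ = a₁σ₁`) and `∂²(z)·a = a·∂(z)` for every `z ∈ G`.
(ii) If (ALD₂) holds on `G`, then `∂a·σ = σ·∂σ·a` (i.e. `a₂σ₁ = σ₁σ₂a₁`). -/
theorem relations_of_ALD1_ALD2 {G : Type*} [Group G] (D : G →* G) (σ a : G)
    (star circ : G → G → G)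
    (hstar : ∀ x y : G, star x y = x * D y * σ * (D x)⁻¹)
    (hcirc : ∀ x y : G, circ x y = x * D y * a) :
    ((∀ x y z : G, star (circ x y) z = star x (star y z)) →
      (D σ * σ * D a = a * σ ∧ ∀ z : G, D (D z) * a = a * D z)) ∧
    ((∀ x y z : G, star x (circ y z) = circ (star x y) (star x z)) →
      D a * σ = σ * D σ * a) := by
  refine ⟨fun h => ?_, fun h => ?_⟩
  · have key : ∀ z : G, a * D z * σ * (D a)⁻¹ = D (D z) * D σ * σ := fun z => by
      simpa [hstar, hcirc, mul_assoc] using h 1 1 z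
    have hσ : a * σ * (D a)⁻¹ = D σ * σ := by simpa using key 1
    refine ⟨(mul_inv_eq_iff_eq_mul.mp hσ).symm, fun z => ?_⟩
    have hz := key z
    rw [mul_assoc (D (D z)), ← hσ] at hz
    simpa only [← mul_assoc, mul_left_inj] using hz.symm
  · simpa [hstar, hcirc, mul_assoc] using h 1 1 1
end
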